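/- arXiv:1104.0359 — 2 statements merged into one kernel-verified Lean document; each statement's English description precedes it below -/
import Mathlib

section
/- Let non-negative random variables L \in RV_{-\beta} and S \in RV_{-\gamma} with 0 < \beta < \gamma satisfy the negligible joint tail condition. Then VaR_\alpha(L + S) \sim VaR_\alpha(L) as \alpha \to 1, i.e., the ratio VaR_\alpha(L+S)/VaR_\alpha(L) tends to 1. -/
open MeasureTheory ProbabilityTheory Filter Topology

/-- Tail probability function of a random variable. -/
noncomputable def tail {Ω : Type*} [MeasurableSpace Ω] (P : Measure Ω) (X : Ω → ℝ) (x : ℝ) : ℝ :=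
  (P {ω | x < X ω}).toReal

/-- Distribution function of a random variable. -/
noncomputable def cdf' {Ω : Type*} [MeasurableSpace Ω] (P : Measure Ω) (X : Ω → ℝ) (x : ℝ) : ℝ :=
  (P {ω | X ω ≤ x}).toReal

/-- Value at Risk: the α-quantile. -/
noncomputable def VaR {Ω : Type*} [MeasurableSpace Ω] (P : Measure Ω) (X : Ω → ℝ) (α : ℝ) : ℝ :=
  sInf {x : ℝ | α ≤ cdf' P X x}

/-- f is regularly varying (at infinity) with index k. -/
def RegVary (f : ℝ → ℝ) (k : ℝ) : Prop :=
  ∀ t : ℝ, 0 < t → Tendsto (fun x => f (t * x) / f x) atTop (𝓝 (t ^ k))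

theorem tail_nonneg {Ω : Type*} [MeasurableSpace Ω] (P : Measure Ω) (X : Ω → ℝ) (x : ℝ) :
    0 ≤ tail P X x := ENNReal.toReal_nonneg

theorem tail_antitone {Ω : Type*} [MeasurableSpace Ω] (P : Measure Ω) [IsFiniteMeasure P]
    (X : Ω → ℝ) : Antitone (tail P X) := fun _ _ hxy =>
  measureReal_mono (μ := P) fun _ hω => lt_of_le_of_lt hxy hω

theorem cdf'_eq_one_sub_tail {Ω : Type*} [MeasurableSpace Ω] (P : Measure Ω)
    [IsProbabilityMeasure P] {X : Ω → ℝ} (hX : Measurable X) (x : ℝ) :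
    cdf' P X x = 1 - tail P X x := by
  have h := probReal_compl_eq_one_sub (μ := P)
    (measurableSet_lt measurable_const hX : MeasurableSet {ω | x < X ω})
  have hc : {ω | x < X ω}ᶜ = {ω | X ω ≤ x} := by ext; simp
  rwa [hc] at h

theorem tail_add_le {Ω : Type*} [MeasurableSpace Ω] (P : Measure Ω) [IsFiniteMeasure P]
    (X Y : Ω → ℝ) (x y : ℝ) :
    tail P (fun ω => X ω + Y ω) (x + y) ≤ tail P X x + tail P Y y := by
  refine (measureReal_mono (μ := P) (s₂ := {ω | x < X ω} ∪ {ω | y < Y ω}) ?_).trans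
    (measureReal_union_le _ _)
  intro ω (hω : x + y < X ω + Y ω)
  by_contra h
  simp only [Set.mem_union, Set.mem_ofPred_eq, not_or, not_lt] at h
  linarith [h.1, h.2]

theorem tendsto_tail_atTop {Ω : Type*} [MeasurableSpace Ω] (P : Measure Ω)
    [IsProbabilityMeasure P] {X : Ω → ℝ} (hX : Measurable X) :
    Tendsto (tail P X) atTop (𝓝 0) := by
  have h := tendsto_measure_iInter_atTop (μ := P) (s := fun x : ℝ => {ω | x < X ω})
    (fun x => (measurableSet_lt measurable_const hX).nullMeasurableSet)
    (fun x y hxy ω hω => lt_of_le_of_lt hxy hω) ⟨0, measure_ne_top _ _⟩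
  have he : ⋂ x : ℝ, {ω | x < X ω} = ∅ := by
    ext ω
    simpa using ⟨X ω, le_rfl⟩
  rw [he, measure_empty] at h
  exact (ENNReal.tendsto_toReal ENNReal.zero_ne_top).comp h

/-- A nonnegative antitone regularly varying function is positive everywhere. -/
theorem RegVary.pos {f : ℝ → ℝ} {k : ℝ} (hf : RegVary f k) (hanti : Antitone f)
    (hnonneg : ∀ x, 0 ≤ f x) (x : ℝ) : 0 < f x := by
  have h := hf 1 one_pos
  simp only [one_mul, Real.one_rpow] at h
  obtain ⟨y, hy, hxy⟩ := ((h.eventually (lt_mem_nhds zero_lt_one)).and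
    (eventually_ge_atTop x)).exists
  have hne : f y ≠ 0 := by
    rintro h0
    simp [h0] at hy
  exact ((hnonneg y).lt_of_ne' hne).trans_le (hanti hxy)

/-- A function bounded on a dyadic block and contracting under doubling tends to zero. -/
theorem tendsto_zero_of_contracting_doubling {r : ℝ → ℝ} {q x₀ M : ℝ} (hr : ∀ x, 0 ≤ r x)
    (hq₀ : 0 ≤ q) (hq₁ : q < 1) (hx₀ : 0 < x₀) (hM : ∀ x, x₀ ≤ x → x ≤ 2 * x₀ → r x ≤ M)
    (hstep : ∀ x, x₀ ≤ x → r (2 * x) ≤ q * r x) : Tendsto r atTop (𝓝 0) := by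
  have hM₀ : 0 ≤ M := (hr x₀).trans (hM x₀ le_rfl (by linarith))
  have hpow (n : ℕ) : ∀ x, x₀ ≤ x → x ≤ 2 * x₀ → r (2 ^ n * x) ≤ M * q ^ n := by
    intro x h₁ h₂
    induction n with
    | zero => simpa using hM x h₁ h₂
    | succ n ih =>
      have hx : x₀ ≤ 2 ^ n * x :=
        h₁.trans (le_mul_of_one_le_left (hx₀.le.trans h₁) (one_le_pow₀ one_le_two))
      calc r (2 ^ (n + 1) * x) = r (2 * (2 ^ n * x)) := by ring_nf
        _ ≤ q * r (2 ^ n * x) := hstep _ hx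
        _ ≤ q * (M * q ^ n) := by gcongr
        _ = M * q ^ (n + 1) := by ring
  have hlim : Tendsto (fun n : ℕ => M * q ^ n) atTop (𝓝 0) := by
    simpa using (tendsto_pow_atTop_nhds_zero_of_lt_one hq₀ hq₁).const_mul M
  rw [tendsto_order]
  refine ⟨fun a ha => .of_forall fun x => ha.trans_le (hr x), fun a ha => ?_⟩
  obtain ⟨N, hN⟩ := (hlim.eventually (gt_mem_nhds ha)).exists
  filter_upwards [eventually_ge_atTop (2 ^ N * x₀), eventually_ge_atTop x₀] with x hxN hx
  obtain ⟨n, hn₁, hn₂⟩ := exists_nat_pow_near ((one_le_div hx₀).2 hx) one_lt_two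
  rw [le_div_iff₀ hx₀] at hn₁
  rw [div_lt_iff₀ hx₀] at hn₂
  have hNn : N ≤ n := by
    have : (2 : ℝ) ^ N < 2 ^ (n + 1) := lt_of_mul_lt_mul_right (hxN.trans_lt hn₂) hx₀.le
    exact Nat.lt_succ_iff.1 ((pow_lt_pow_iff_right₀ one_lt_two).1 this)
  have h2 : (0 : ℝ) < 2 ^ n := by positivity
  have h := hpow n (x / 2 ^ n) (by rw [le_div_iff₀ h2]; linarith)
    (by rw [div_le_iff₀ h2]; rw [pow_succ] at hn₂; linarith)
  rw [mul_div_cancel₀ _ h2.ne'] at h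
  exact (h.trans (mul_le_mul_of_nonneg_left
    (pow_le_pow_of_le_one hq₀ hq₁.le hNn) hM₀)).trans_lt hN

/-- Among antitone regularly varying functions, the one of smaller index is negligible. -/
theorem RegVary.tendsto_div_zero {f g : ℝ → ℝ} {k l : ℝ} (hf : RegVary f k) (hg : RegVary g l)
    (hlk : l < k) (hfa : Antitone f) (hga : Antitone g) (hf₀ : ∀ x, 0 ≤ f x)
    (hg₀ : ∀ x, 0 ≤ g x) : Tendsto (fun x => g x / f x) atTop (𝓝 0) := by
  have hfp := hf.pos hfa hf₀
  have hgp := hg.pos hga hg₀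
  have hlim := (hg 2 two_pos).div (hf 2 two_pos) (by positivity)
  rw [← Real.rpow_sub two_pos] at hlim
  have hlt : (2 : ℝ) ^ (l - k) < 1 :=
    Real.rpow_lt_one_of_one_lt_of_neg one_lt_two (by linarith)
  obtain ⟨q, hq, hq₁⟩ := exists_between hlt
  have hq₀ : 0 < q := lt_trans (by positivity) hq
  obtain ⟨x₁, hx₁⟩ := eventually_atTop.1 (hlim.eventually (gt_mem_nhds hq))
  set x₀ := max x₁ 1
  refine tendsto_zero_of_contracting_doubling (x₀ := x₀) (M := g x₀ / f (2 * x₀))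
    (fun x => div_nonneg (hg₀ x) (hf₀ x)) hq₀.le hq₁ (lt_max_of_lt_right one_pos) ?_ ?_
  · intro x h₁ h₂
    exact div_le_div₀ (hg₀ _) (hga h₁) (hfp _) (hfa h₂)
  · intro x hx
    have h := hx₁ x ((le_max_left _ _).trans hx)
    have := hfp x; have := hgp x; have := hfp (2 * x)
    simp only [Pi.div_apply] at h
    rw [div_div_div_comm, div_lt_iff₀ (by positivity)] at h
    exact h.le

/-- If `Y` has regularly varying tail of smaller index than that of `X`, then adding `Y` to `X`
and stretching the threshold by a factor larger than one gives a smaller tail. -/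
theorem eventually_tail_add_le {Ω : Type*} [MeasurableSpace Ω] (P : Measure Ω)
    [IsProbabilityMeasure P] {X Y : Ω → ℝ} {k l : ℝ} (hX : RegVary (tail P X) k)
    (hY : RegVary (tail P Y) l) (hk : k < 0) (hlk : l < k) {c : ℝ} (hc : 1 < c) :
    ∀ᶠ x in atTop, tail P (fun ω => X ω + Y ω) (c * x) ≤ tail P X x := by
  have hXp := hX.pos (tail_antitone P X) (tail_nonneg P X)
  have hYp := hY.pos (tail_antitone P Y) (tail_nonneg P Y)
  obtain ⟨d, hd₁, hdc⟩ := exists_between hc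
  have hlim := (hX d (by linarith)).add ((hY (c - d) (by linarith)).mul
    (hX.tendsto_div_zero hY hlk (tail_antitone P X) (tail_antitone P Y)
      (tail_nonneg P X) (tail_nonneg P Y)))
  rw [mul_zero, add_zero] at hlim
  filter_upwards [hlim.eventually (gt_mem_nhds (Real.rpow_lt_one_of_one_lt_of_neg hd₁ hk))]
    with x hx
  have h := tail_add_le P X Y (d * x) ((c - d) * x)
  rw [div_mul_div_cancel₀ (hYp x).ne', ← add_div, div_lt_one (hXp x)] at hx
  rw [← add_mul, add_sub_cancel] at h
  exact h.trans hx.le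

theorem exists_le_cdf' {Ω : Type*} [MeasurableSpace Ω] (P : Measure Ω)
    [IsProbabilityMeasure P] {X : Ω → ℝ} (hX : Measurable X) {α : ℝ} (hα : α < 1) :
    ∃ x, α ≤ cdf' P X x := by
  obtain ⟨x, hx⟩ :=
    ((tendsto_tail_atTop P hX).eventually (gt_mem_nhds (sub_pos.2 hα))).exists
  exact ⟨x, by rw [cdf'_eq_one_sub_tail P hX]; linarith⟩

theorem le_of_cdf'_lt {Ω : Type*} [MeasurableSpace Ω] (P : Measure Ω) [IsFiniteMeasure P]
    {X : Ω → ℝ} {α x₀ x : ℝ} (h₀ : cdf' P X x₀ < α) (h : α ≤ cdf' P X x) : x₀ ≤ x := by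
  by_contra! hlt
  have : cdf' P X x ≤ cdf' P X x₀ :=
    measureReal_mono (μ := P) fun ω (hω : X ω ≤ x) => hω.trans hlt.le
  linarith

theorem stmt2 {Ω : Type*} [MeasurableSpace Ω] (P : Measure Ω) [IsProbabilityMeasure P]
    (L S : Ω → ℝ) (hL : Measurable L) (hS : Measurable S)
    (hLpos : ∀ ω, 0 ≤ L ω) (hSpos : ∀ ω, 0 ≤ S ω)
    (β γ : ℝ) (hβ : 0 < β) (hβγ : β < γ)
    (hRVL : RegVary (tail P L) (-β)) (hRVS : RegVary (tail P S) (-γ))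
    (hjoint : Tendsto (fun x => (P {ω | x < L ω ∧ x < S ω}).toReal / (tail P L x + tail P S x))
      atTop (𝓝 0)) :
    Tendsto (fun α => VaR P (fun ω => L ω + S ω) α / VaR P L α) (𝓝[<] (1 : ℝ)) (𝓝 1) := by
  have hLS : Measurable (fun ω => L ω + S ω) := hL.add hS
  have hLp := hRVL.pos (tail_antitone P L) (tail_nonneg P L)
  have hcdf (x : ℝ) : cdf' P (fun ω => L ω + S ω) x ≤ cdf' P L x :=
    measureReal_mono (μ := P) fun ω (hω : L ω + S ω ≤ x) =>
      (le_add_of_nonneg_right (hSpos ω)).trans hω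
  have hmain (c : ℝ) (hc : 1 < c) : ∀ᶠ α in 𝓝[<] (1 : ℝ),
      1 ≤ VaR P (fun ω => L ω + S ω) α / VaR P L α ∧
        VaR P (fun ω => L ω + S ω) α / VaR P L α ≤ c := by
    obtain ⟨x₁, hx₁⟩ := eventually_atTop.1
      (eventually_tail_add_le P hRVL hRVS (neg_lt_zero.2 hβ) (neg_lt_neg hβγ) hc)
    set x₀ := max x₁ 1
    have hx₀ : cdf' P L x₀ < 1 := by
      rw [cdf'_eq_one_sub_tail P hL]
      linarith [hLp x₀]
    filter_upwards [self_mem_nhdsWithin, nhdsWithin_le_nhds (lt_mem_nhds hx₀)]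
      with α (hα₁ : α < 1) hα
    have hlow {x : ℝ} (hx : α ≤ cdf' P L x) : x₀ ≤ x := le_of_cdf'_lt P hα hx
    have hVpos : 0 < VaR P L α :=
      (lt_max_of_lt_right one_pos).trans_le
        (le_csInf (exists_le_cdf' P hL hα₁) fun _ => hlow)
    have hle : VaR P L α ≤ VaR P (fun ω => L ω + S ω) α :=
      csInf_le_csInf ⟨x₀, fun _ => hlow⟩ (exists_le_cdf' P hLS hα₁)
        fun x hx => le_trans hx (hcdf x)
    refine ⟨(one_le_div hVpos).2 hle, (div_le_iff₀ hVpos).2 ?_⟩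
    rw [← div_le_iff₀' (by linarith)]
    refine le_csInf (exists_le_cdf' P hL hα₁) fun x (hx : α ≤ cdf' P L x) => ?_
    rw [div_le_iff₀' (by linarith)]
    refine csInf_le ⟨x₀, fun y hy => hlow (le_trans hy (hcdf y))⟩ ?_
    have h := hx₁ x ((le_max_left _ _).trans (hlow hx))
    rw [cdf'_eq_one_sub_tail P hL] at hx
    change α ≤ cdf' P _ _
    rw [cdf'_eq_one_sub_tail P hLS]
    linarith
  rw [tendsto_order]
  refine ⟨fun a ha => ?_, fun a ha => ?_⟩
  · filter_upwards [hmain 2 one_lt_two] with α hα using ha.trans_le hα.1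
  · obtain ⟨c, hc, hca⟩ := exists_between ha
    filter_upwards [hmain c hc] with α hα using hα.2.trans_lt hca
end

section
/- Let (L, S) be non-negative random variables with L \in RV_{-\beta}, S \in RV_{-\gamma}, \beta + 1 < \gamma, satisfying the conditional density and uniformity conditions [E] and [F]. Then VaR_\alpha(L+S) - VaR_\alpha(L) \sim E[S | L = VaR_\alpha(L)] as \alpha \to 1. -/
open MeasureTheory ProbabilityTheory Filter Topology

/-- A function contracted by doublings of its argument tends to zero. -/
lemma tendsto_zero_of_doubling {r : ℝ → ℝ} {X ρ M : ℝ} (hX : 0 < X) (hρ : 0 ≤ ρ) (hρ1 : ρ < 1)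
    (hr : ∀ x, X ≤ x → 0 ≤ r x) (h2 : ∀ x, X ≤ x → r (2 * x) ≤ ρ * r x)
    (hM : ∀ x, X ≤ x → x ≤ 2 * X → r x ≤ M) : Tendsto r atTop (𝓝 0) := by
  have hM0 : 0 ≤ M := (hr X le_rfl).trans (hM X le_rfl (by linarith))
  have key : ∀ n : ℕ, ∀ x, X ≤ x → x ≤ 2 ^ (n + 1) * X → r x ≤ M := by
    intro n
    induction n with
    | zero => intro x h1 h3; exact hM x h1 (by simpa using h3)
    | succ n ih =>
      intro x h1 h3
      by_cases hx : x ≤ 2 * X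
      · exact hM x h1 hx
      · push Not at hx
        have h4 := h2 (x / 2) (by linarith)
        have h5 := ih (x / 2) (by linarith) (by rw [pow_succ] at h3; linarith)
        have h6 := hr (x / 2) (by linarith)
        rw [mul_div_cancel₀ x two_ne_zero] at h4
        nlinarith
  have bdd : ∀ x, X ≤ x → r x ≤ M := by
    intro x hx
    obtain ⟨n, hn⟩ := pow_unbounded_of_one_lt (x / X) (one_lt_two : (1 : ℝ) < 2)
    refine key n x hx ?_
    rw [div_lt_iff₀ hX] at hn
    rw [pow_succ]
    have : 0 < 2 ^ n * X := by positivity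
    linarith
  have decay : ∀ n : ℕ, ∀ x, 2 ^ n * X ≤ x → r x ≤ ρ ^ n * M := by
    intro n
    induction n with
    | zero => intro x h1; simpa using bdd x (by simpa using h1)
    | succ n ih =>
      intro x h1
      have h3 : 2 ^ n * X ≤ x / 2 := by rw [pow_succ] at h1; linarith
      have h7 : X ≤ 2 ^ n * X := le_mul_of_one_le_left hX.le (one_le_pow₀ one_le_two)
      have h4 := h2 (x / 2) (h7.trans h3)
      rw [mul_div_cancel₀ x two_ne_zero] at h4
      calc r x ≤ ρ * r (x / 2) := h4
        _ ≤ ρ * (ρ ^ n * M) := by gcongr; exact ih _ h3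
        _ = ρ ^ (n + 1) * M := by ring
  rw [Metric.tendsto_atTop]
  intro ε hε
  have hlim : Tendsto (fun n : ℕ => ρ ^ n * M) atTop (𝓝 (0 * M)) :=
    (tendsto_pow_atTop_nhds_zero_of_lt_one hρ hρ1).mul_const M
  rw [zero_mul] at hlim
  obtain ⟨n, hn⟩ := (hlim.eventually (gt_mem_nhds hε)).exists
  refine ⟨2 ^ n * X, fun x hx => ?_⟩
  have h7 : X ≤ 2 ^ n * X := le_mul_of_one_le_left hX.le (one_le_pow₀ one_le_two)
  rw [Real.dist_eq, sub_zero, abs_of_nonneg (hr x (h7.trans hx))]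
  exact (decay n x hx).trans_lt hn

/-- A quotient of monotone functions whose dyadic ratios have a limit below one tends to zero. -/
lemma tendsto_div_zero {u v : ℝ → ℝ} {x₁ l : ℝ} (hl : l < 1)
    (hu : ∀ x, x₁ ≤ x → 0 < u x) (hv : ∀ x, x₁ ≤ x → 0 < v x)
    (hua : ∀ X, x₁ ≤ X → ∃ M, ∀ x, X ≤ x → x ≤ 2 * X → u x ≤ M)
    (hva : ∀ X, x₁ ≤ X → ∃ c > 0, ∀ x, X ≤ x → x ≤ 2 * X → c ≤ v x)
    (hlim : Tendsto (fun x => (u (2 * x) / v (2 * x)) / (u x / v x)) atTop (𝓝 l)) :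
    Tendsto (fun x => u x / v x) atTop (𝓝 0) := by
  have hl0 : 0 ≤ l := by
    refine ge_of_tendsto hlim ?_
    filter_upwards [eventually_ge_atTop x₁, eventually_ge_atTop 0] with x hx hx0
    have := hu x hx; have := hv x hx
    have := hu (2 * x) (by linarith); have := hv (2 * x) (by linarith)
    positivity
  obtain ⟨ρ, hρl, hρ1⟩ := exists_between hl
  obtain ⟨X₀, hX₀⟩ := eventually_atTop.1 (hlim.eventually (gt_mem_nhds hρl))
  set X := max X₀ (max x₁ 1)
  have hXX : X₀ ≤ X := le_max_left _ _
  have hX1 : x₁ ≤ X := (le_max_left _ _).trans (le_max_right _ _)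
  have hXp : 0 < X := one_pos.trans_le ((le_max_right _ _).trans (le_max_right _ _))
  obtain ⟨M, hM⟩ := hua X hX1
  obtain ⟨c, hc, hcv⟩ := hva X hX1
  refine tendsto_zero_of_doubling (X := X) (ρ := ρ) (M := M / c) hXp (hl0.trans hρl.le) hρ1
    (fun x hx => (div_pos (hu x (hX1.trans hx)) (hv x (hX1.trans hx))).le) (fun x hx => ?_)
    (fun x hx hx2 => ?_)
  · have h1 := (hX₀ x (hXX.trans hx)).le
    rwa [div_le_iff₀ (div_pos (hu x (hX1.trans hx)) (hv x (hX1.trans hx)))] at h1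
  · have h1 := hM x hx hx2
    have h2 := hu x (hX1.trans hx)
    exact div_le_div₀ (h2.le.trans h1) h1 hc (hcv x hx hx2)

/-- Reversing the scaling in a ratio limit. -/
lemma tendsto_ratio_two {W : ℝ → ℝ} {κ : ℝ}
    (hW : ∀ t ∈ Set.Ioo (0 : ℝ) 1, Tendsto (fun x => W (t * x) / W x) atTop (𝓝 (t ^ (-κ)))) :
    Tendsto (fun x => W x / W (2 * x)) atTop (𝓝 (2 ^ κ)) := by
  have h := (hW (1 / 2) ⟨by norm_num, by norm_num⟩).comp
    (tendsto_id.const_mul_atTop (two_pos : (0 : ℝ) < 2))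
  have e : ((1 : ℝ) / 2) ^ (-κ) = 2 ^ κ := by
    rw [one_div, Real.inv_rpow two_pos.le, Real.rpow_neg two_pos.le, inv_inv]
  rw [e] at h
  refine h.congr fun x => ?_
  simp only [Function.comp, id]
  congr 2
  ring

lemma exists_ratio_le {W : ℝ → ℝ} {κ : ℝ} (hpos : ∀ᶠ x in atTop, 0 < W x)
    (hW : ∀ t ∈ Set.Ioo (0 : ℝ) 1, Tendsto (fun x => W (t * x) / W x) atTop (𝓝 (t ^ (-κ))))
    {ε : ℝ} (hε : 0 < ε) :
    ∀ᶠ t in 𝓝[<] (1 : ℝ), t ∈ Set.Ioo (0 : ℝ) 1 ∧ ∀ᶠ x in atTop, W (t * x) ≤ (1 + ε) * W x := by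
  have hc : Tendsto (fun t : ℝ => t ^ (-κ)) (𝓝[<] 1) (𝓝 1) := by
    have := (Real.continuousAt_rpow_const 1 (-κ) (Or.inl one_ne_zero)).tendsto
    rw [Real.one_rpow] at this
    exact this.mono_left nhdsWithin_le_nhds
  filter_upwards [hc.eventually (gt_mem_nhds (show (1 : ℝ) < 1 + ε by linarith)),
    Ioo_mem_nhdsLT (zero_lt_one' ℝ)] with t ht ht01
  refine ⟨ht01, ?_⟩
  filter_upwards [(hW t ht01).eventually (gt_mem_nhds ht), hpos] with x hx hp
  exact ((div_lt_iff₀ hp).1 hx).le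

/-- If the excess `D` is squeezed between `G` and a rescaled `G` up to the negligible tail `T`,
then `D` is asymptotically equivalent to `G`. -/
lemma excess_equiv {G T D : ℝ → ℝ} {κ : ℝ} (hG : ∀ᶠ x in atTop, 0 < G x)
    (hGr : ∀ t ∈ Set.Ioo (0 : ℝ) 1, Tendsto (fun x => G (t * x) / G x) atTop (𝓝 (t ^ (-κ))))
    (hTG : Tendsto (fun x => T x / G x) atTop (𝓝 0)) {c : ℝ}
    (hlow : ∀ᶠ z in atTop, G z - c * T (1 / 2 * z) ≤ D z)
    (hup : ∀ t ∈ Set.Ioo (0 : ℝ) 1, ∀ᶠ z in atTop, D z ≤ G (t * z) + T ((1 - t) * z))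
    {ε : ℝ} (hε : 0 < ε) :
    ∀ᶠ z in atTop, (1 - ε) * G z ≤ D z ∧ D z ≤ (1 + ε) * G z := by
  have hT : ∀ t ∈ Set.Ioo (0 : ℝ) 1, Tendsto (fun x => T (t * x) / G x) atTop (𝓝 0) := by
    intro t ht
    have h1 := (hTG.comp (tendsto_id.const_mul_atTop ht.1)).mul (hGr t ht)
    rw [zero_mul] at h1
    refine h1.congr' ?_
    filter_upwards [(tendsto_id.const_mul_atTop ht.1).eventually hG] with x hx
    simp only [Function.comp, id] at hx ⊢
    field_simp
  obtain ⟨t, ht, hGt⟩ := (exists_ratio_le hG hGr (half_pos hε)).exists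
  have h1 := hT (1 - t) ⟨by linarith [ht.2], by linarith [ht.1]⟩
  have h2 := (hT (1 / 2) ⟨by norm_num, by norm_num⟩).const_mul c
  rw [mul_zero] at h2
  filter_upwards [hG, hGt, hlow, hup t ht, h1.eventually (gt_mem_nhds (half_pos hε)),
    h2.eventually (gt_mem_nhds hε)] with z h3 h4 h5 h6 h7 h8
  rw [← mul_div_assoc] at h8
  rw [div_lt_iff₀ h3] at h7 h8
  constructor <;> nlinarith

/-- First-order inversion: shifting `q` by `(1 ± ε) G q / f q` over- or undershoots the excess. -/
lemma shift_bounds {G f D : ℝ → ℝ} {κ x₁ ε : ℝ} (hε : 0 < ε) (hε1 : ε < 1)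
    (hG : ∀ x, x₁ ≤ x → 0 < G x) (hGa : ∀ x y, x₁ ≤ x → x ≤ y → G y ≤ G x)
    (hGr : ∀ t ∈ Set.Ioo (0 : ℝ) 1, Tendsto (fun x => G (t * x) / G x) atTop (𝓝 (t ^ (-κ))))
    (hf : ∀ x, x₁ ≤ x → 0 < f x) (hfa : ∀ x y, x₁ ≤ x → x ≤ y → f y ≤ f x)
    (hfr : ∀ t ∈ Set.Ioo (0 : ℝ) 1, Tendsto (fun x => f (t * x) / f x) atTop (𝓝 (t ^ (-κ))))
    (hD : ∀ ε > 0, ∀ᶠ z in atTop, (1 - ε) * G z ≤ D z ∧ D z ≤ (1 + ε) * G z) :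
    ∀ᶠ q in atTop,
      D (q + (1 + ε) * (G q / f q)) ≤ ∫ y in q..(q + (1 + ε) * (G q / f q)), f y ∧
      ∫ y in q..(q + (1 - ε) * (G q / f q)), f y < D (q + (1 - ε) * (G q / f q)) := by
  have hε3 : 0 < ε / 3 := by linarith
  have hm : Tendsto (fun x => G x / (x * f x)) atTop (𝓝 0) := by
    refine tendsto_div_zero (x₁ := max x₁ 1) (l := 1 / 2) (by norm_num)
      (fun x hx => hG x ((le_max_left _ _).trans hx))
      (fun x hx => mul_pos (one_pos.trans_le ((le_max_right _ _).trans hx))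
        (hf x ((le_max_left _ _).trans hx)))
      (fun X hX => ⟨G X, fun x hx _ => hGa X x ((le_max_left _ _).trans hX) hx⟩)
      (fun X hX => ?_) ?_
    · have h1 : 1 ≤ X := (le_max_right _ _).trans hX
      have h2 : x₁ ≤ X := (le_max_left _ _).trans hX
      have h3 := hf (2 * X) (by linarith)
      refine ⟨X * f (2 * X), by positivity, fun x hx hx2 => ?_⟩
      have := hfa x (2 * X) (h2.trans hx) hx2
      have : 0 ≤ x := by linarith
      gcongr
    · have h1 := (tendsto_ratio_two hfr).div (tendsto_ratio_two hGr) (by positivity)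
      have h2 := h1.const_mul (1 / 2)
      rw [div_self (by positivity), mul_one] at h2
      refine h2.congr' ?_
      filter_upwards [eventually_ge_atTop x₁, eventually_gt_atTop 0] with x hx hx0
      have h3 := hf x hx
      have h4 := hf (2 * x) (by linarith)
      have h5 := hG x hx
      have h6 := hG (2 * x) (by linarith)
      simp only [Pi.div_apply]
      field_simp
  have hfe : ∀ᶠ x in atTop, 0 < f x := eventually_atTop.2 ⟨x₁, hf⟩
  have hGe : ∀ᶠ x in atTop, 0 < G x := eventually_atTop.2 ⟨x₁, hG⟩
  obtain ⟨t, ⟨ht, hGt⟩, -, hft⟩ :=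
    ((exists_ratio_le hGe hGr hε3).and (exists_ratio_le hfe hfr hε3)).exists
  obtain ⟨Z, hZ⟩ := eventually_atTop.1 (hGt.and (hft.and (hD (ε / 3) hε3)))
  have ht' : 0 < (1 / t - 1) / 2 := by
    have := (one_lt_div ht.1).2 ht.2
    linarith
  filter_upwards [eventually_ge_atTop Z, eventually_ge_atTop x₁, eventually_gt_atTop 0,
    hm.eventually (gt_mem_nhds ht'), eventually_ge_atTop (x₁ / t)] with q hqZ hqx hq0 hqm hqt
  have hfq := hf q hqx
  have hGq := hG q hqx
  set m := G q / f q with hmdef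
  have hm0 : 0 < m := div_pos hGq hfq
  have hmG : m * f q = G q := div_mul_cancel₀ _ hfq.ne'
  have hmq : t * (q + 2 * m) ≤ q := by
    have h1 : m < (1 / t - 1) / 2 * q := by
      rw [← div_lt_iff₀ hq0, hmdef, div_div, mul_comm (f q)]
      exact hqm
    have h2 : t * (q + 2 * ((1 / t - 1) / 2 * q)) = q := by
      have := ht.1
      field_simp
      ring
    have := ht.1
    calc t * (q + 2 * m) ≤ t * (q + 2 * ((1 / t - 1) / 2 * q)) := by gcongr
      _ = q := h2
  have main : ∀ a, 0 < a → a ≤ 2 → G (q + a * m) ≤ G q ∧ G q ≤ (1 + ε / 3) * G (q + a * m) ∧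
      f q ≤ (1 + ε / 3) * f (q + a * m) ∧ (1 - ε / 3) * G (q + a * m) ≤ D (q + a * m) ∧
      D (q + a * m) ≤ (1 + ε / 3) * G (q + a * m) ∧
      a * m * f (q + a * m) ≤ ∫ y in q..(q + a * m), f y ∧
      ∫ y in q..(q + a * m), f y ≤ a * m * f q := by
    intro a ha ha2
    have hle : q ≤ q + a * m := by
      have := mul_pos ha hm0
      linarith
    obtain ⟨h1, h2, h3, h4⟩ := hZ (q + a * m) (hqZ.trans hle)
    have h5 : t * (q + a * m) ≤ q := by
      refine le_trans ?_ hmq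
      have := ht.1
      gcongr
    have h6 : x₁ ≤ t * (q + a * m) := by
      rw [div_le_iff₀ ht.1] at hqt
      nlinarith [ht.1]
    have hint : IntervalIntegrable f volume q (q + a * m) := by
      refine AntitoneOn.intervalIntegrable fun x hx y _ hxy => hfa x y ?_ hxy
      rw [Set.uIcc_of_le hle] at hx
      exact hqx.trans hx.1
    have h7 := intervalIntegral.integral_mono_on hle (intervalIntegrable_const (μ := volume)) hint
      (fun y hy => hfa y (q + a * m) (hqx.trans hy.1) hy.2)
    have h8 := intervalIntegral.integral_mono_on hle hint (intervalIntegrable_const (μ := volume))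
      (fun y hy => hfa q y hqx hy.1)
    rw [intervalIntegral.integral_const, add_sub_cancel_left, smul_eq_mul] at h7 h8
    exact ⟨hGa q _ hqx hle, (hGa _ q h6 h5).trans h1, (hfa _ q h6 h5).trans h2, h3, h4, h7, h8⟩
  constructor
  · obtain ⟨h1, -, h3, -, h5, h6, -⟩ := main (1 + ε) (by linarith) (by linarith)
    refine h5.trans (le_trans ?_ h6)
    have hfz : 0 < f (q + (1 + ε) * m) := by nlinarith
    calc (1 + ε / 3) * G (q + (1 + ε) * m) ≤ (1 + ε / 3) * (m * f q) := by rw [hmG]; gcongr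
      _ ≤ (1 + ε / 3) * (m * ((1 + ε / 3) * f (q + (1 + ε) * m))) := by gcongr
      _ = ((1 + ε / 3) * (1 + ε / 3)) * m * f (q + (1 + ε) * m) := by ring
      _ ≤ (1 + ε) * m * f (q + (1 + ε) * m) := by
        gcongr
        nlinarith
  · obtain ⟨-, h2, -, h4, -, -, h7⟩ := main (1 - ε) (by linarith) (by linarith)
    refine h7.trans_lt (lt_of_lt_of_le ?_ h4)
    have hGz : 0 < G (q + (1 - ε) * m) := by nlinarith
    have h8 : 0 < 1 - ε := by linarith
    calc (1 - ε) * m * f q = (1 - ε) * G q := by rw [mul_assoc, hmG]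
      _ ≤ (1 - ε) * ((1 + ε / 3) * G (q + (1 - ε) * m)) := by gcongr
      _ = ((1 - ε) * (1 + ε / 3)) * G (q + (1 - ε) * m) := by ring
      _ < (1 - ε / 3) * G (q + (1 - ε) * m) := by
        gcongr
        nlinarith

/-- Karamata-type bound for the truncated first moment of a measure with fast decaying tail. -/
lemma lintegral_Ioi_le_of_doubling {μ : Measure ℝ} [IsFiniteMeasure μ] {X ρ : ℝ} (hX : 0 < X)
    (hρ : 0 ≤ ρ) (hρ2 : ρ < 1 / 2)
    (h : ∀ x, X ≤ x → μ.real (Set.Ioi (2 * x)) ≤ ρ * μ.real (Set.Ioi x)) {x : ℝ} (hx : X ≤ x) :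
    ∫⁻ s in Set.Ioi x, ENNReal.ofReal s ∂μ ≤
      ENNReal.ofReal (2 * (1 - 2 * ρ)⁻¹ * (x * μ.real (Set.Ioi x))) := by
  have hx0 : 0 < x := hX.trans_le hx
  have htail : ∀ n : ℕ, μ (Set.Ioi (2 ^ n * x)) ≤ ENNReal.ofReal (ρ ^ n * μ.real (Set.Ioi x)) := by
    intro n
    rw [← ENNReal.ofReal_toReal (measure_ne_top μ (Set.Ioi (2 ^ n * x)))]
    refine ENNReal.ofReal_le_ofReal ?_
    change μ.real _ ≤ _
    induction n with
    | zero => simp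
    | succ n ih =>
      have h7 : x ≤ 2 ^ n * x := le_mul_of_one_le_left hx0.le (one_le_pow₀ one_le_two)
      calc μ.real (Set.Ioi (2 ^ (n + 1) * x)) = μ.real (Set.Ioi (2 * (2 ^ n * x))) := by
            rw [pow_succ]; ring_nf
        _ ≤ ρ * μ.real (Set.Ioi (2 ^ n * x)) := h _ (hx.trans h7)
        _ ≤ ρ * (ρ ^ n * μ.real (Set.Ioi x)) := by gcongr
        _ = ρ ^ (n + 1) * μ.real (Set.Ioi x) := by ring
  have hpt : ∀ s ∈ Set.Ioi x, ENNReal.ofReal s ≤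
      ∑' n : ℕ, ENNReal.ofReal (2 ^ (n + 1) * x) * (Set.Ioi (2 ^ n * x)).indicator 1 s := by
    intro s hs
    have hex : ∃ n : ℕ, s ≤ 2 ^ n * x := by
      obtain ⟨n, hn⟩ := pow_unbounded_of_one_lt (s / x) (one_lt_two : (1 : ℝ) < 2)
      exact ⟨n, ((div_lt_iff₀ hx0).1 hn).le⟩
    classical
    obtain ⟨k, hk⟩ : ∃ k, Nat.find hex = k + 1 := by
      refine Nat.exists_eq_succ_of_ne_zero fun h0 => ?_
      have := Nat.find_spec hex
      rw [h0, pow_zero, one_mul] at this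
      exact absurd hs (not_lt.2 this)
    have h1 := Nat.find_spec hex
    have h2 := Nat.find_min hex (m := k) (by omega)
    rw [hk] at h1
    push Not at h2
    refine le_trans ?_ (ENNReal.le_tsum k)
    rw [Set.indicator_of_mem (show s ∈ Set.Ioi (2 ^ k * x) from h2)]
    simpa using ENNReal.ofReal_le_ofReal h1
  have hs2 : Summable fun n : ℕ => 2 * (x * μ.real (Set.Ioi x)) * (2 * ρ) ^ n :=
    (summable_geometric_of_lt_one (by linarith) (by linarith)).mul_left _
  calc ∫⁻ s in Set.Ioi x, ENNReal.ofReal s ∂μ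
      ≤ ∫⁻ s in Set.Ioi x,
        ∑' n : ℕ, ENNReal.ofReal (2 ^ (n + 1) * x) * (Set.Ioi (2 ^ n * x)).indicator 1 s ∂μ :=
        setLIntegral_mono' measurableSet_Ioi hpt
    _ ≤ ∫⁻ s, ∑' n : ℕ,
        ENNReal.ofReal (2 ^ (n + 1) * x) * (Set.Ioi (2 ^ n * x)).indicator 1 s ∂μ :=
        setLIntegral_le_lintegral _ _
    _ = ∑' n : ℕ, ENNReal.ofReal (2 ^ (n + 1) * x) * μ (Set.Ioi (2 ^ n * x)) := by
        rw [lintegral_tsum fun n => by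
          exact ((measurable_one.indicator measurableSet_Ioi).const_mul _).aemeasurable]
        refine tsum_congr fun n => ?_
        rw [lintegral_const_mul _ (measurable_one.indicator measurableSet_Ioi),
          lintegral_indicator_one measurableSet_Ioi]
    _ ≤ ∑' n : ℕ, ENNReal.ofReal (2 * (x * μ.real (Set.Ioi x)) * (2 * ρ) ^ n) := by
        refine ENNReal.tsum_le_tsum fun n => ?_
        refine (mul_le_mul_right (htail n) _).trans_eq ?_
        rw [← ENNReal.ofReal_mul (by positivity)]
        congr 1
        rw [mul_pow, pow_succ]
        ring
    _ = ENNReal.ofReal (2 * (1 - 2 * ρ)⁻¹ * (x * μ.real (Set.Ioi x))) := by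
        rw [← ENNReal.ofReal_tsum_of_nonneg (fun n => by positivity) hs2, tsum_mul_left,
          tsum_geometric_of_lt_one (by linarith) (by linarith)]
        congr 1
        ring

/-- Uniform regular variation of the densities passes to weighted mixtures. -/
lemma tendsto_mixture_ratio {μ : Measure ℝ} {f : ℝ → ℝ → ℝ} {w : ℝ → ℝ} {x₁ κ t : ℝ}
    (ht : 0 < t) (hw : ∀ᵐ s ∂μ, 0 ≤ w s) (hf : ∀ᵐ s ∂μ, ∀ x, x₁ ≤ x → 0 < f s x)
    (hint : ∀ x, x₁ ≤ x → Integrable (fun s => w s * f s x) μ)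
    (hW : ∀ x, x₁ ≤ x → 0 < ∫ s, w s * f s x ∂μ)
    (hF : ∀ ε > 0, ∃ X₀ : ℝ, ∀ x ≥ X₀, ∀ᵐ s ∂μ, |f s (t * x) / f s x - t ^ (-κ)| ≤ ε) :
    Tendsto (fun x => (∫ s, w s * f s (t * x) ∂μ) / ∫ s, w s * f s x ∂μ) atTop
      (𝓝 (t ^ (-κ))) := by
  rw [Metric.tendsto_nhds]
  intro ε hε
  obtain ⟨X₀, hX₀⟩ := hF (ε / 2) (half_pos hε)
  filter_upwards [eventually_ge_atTop X₀, eventually_ge_atTop x₁,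
    eventually_ge_atTop (x₁ / t)] with x h1 h2 h3
  rw [div_le_iff₀ ht, mul_comm] at h3
  have hWx := hW x h2
  have key : |(∫ s, w s * f s (t * x) ∂μ) - t ^ (-κ) * ∫ s, w s * f s x ∂μ| ≤
      ε / 2 * ∫ s, w s * f s x ∂μ := by
    rw [← integral_const_mul, ← integral_const_mul,
      ← integral_sub (hint _ h3) ((hint x h2).const_mul _)]
    refine (abs_integral_le_integral_abs).trans (integral_mono_ae ?_ ((hint x h2).const_mul _) ?_)
    · exact ((hint _ h3).sub ((hint x h2).const_mul _)).abs
    · filter_upwards [hw, hf, hX₀ x h1] with s hs1 hs2 hs3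
      have hp := hs2 x h2
      have e : w s * f s (t * x) - t ^ (-κ) * (w s * f s x) =
          (w s * f s x) * (f s (t * x) / f s x - t ^ (-κ)) := by
        field_simp
      rw [e, abs_mul, abs_of_nonneg (by positivity), mul_comm]
      gcongr
  rw [Real.dist_eq]
  have e : (∫ s, w s * f s (t * x) ∂μ) / (∫ s, w s * f s x ∂μ) - t ^ (-κ) =
      ((∫ s, w s * f s (t * x) ∂μ) - t ^ (-κ) * ∫ s, w s * f s x ∂μ) / ∫ s, w s * f s x ∂μ := by
    field_simp
  rw [e, abs_div, abs_of_pos hWx]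
  refine lt_of_le_of_lt ((div_le_iff₀ hWx).2 key) (by linarith)

lemma eq_of_eq_on_rat {c h : ℝ → ℝ} {x₀ M : ℝ} (hM : 0 ≤ M) (hc : Monotone c)
    (hh : ∀ x y, x₀ ≤ x → x ≤ y → h y - h x ≤ M * (y - x))
    (heq : ∀ q : ℚ, x₀ < q → c q = h q) {x : ℝ} (hx : x₀ < x) : c x = h x := by
  have hδ : ∀ ε > 0, ∃ δ > 0, M * δ ≤ ε := fun ε hε =>
    ⟨ε / (M + 1), by positivity, by
      rw [← mul_div_assoc, div_le_iff₀ (by positivity)]; nlinarith⟩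
  apply le_antisymm
  · refine le_of_forall_pos_le_add fun ε hε => ?_
    obtain ⟨δ, hδ0, hδ⟩ := hδ ε hε
    obtain ⟨q, hq1, hq2⟩ := exists_rat_btwn (show x < x + δ by linarith)
    have h1 := hc hq1.le
    have h2 := hh x q hx.le hq1.le
    rw [heq q (hx.trans hq1)] at h1
    nlinarith
  · refine le_of_forall_pos_le_add fun ε hε => ?_
    obtain ⟨δ, hδ0, hδ⟩ := hδ ε hε
    obtain ⟨q, hq1, hq2⟩ := exists_rat_btwn (show max x₀ (x - δ) < x from
      max_lt hx (by linarith))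
    have h0 := (le_max_left _ _).trans_lt hq1
    have h0' := (le_max_right _ _).trans_lt hq1
    have h1 := hc hq2.le
    have h2 := hh q x h0.le hq2.le
    rw [heq q h0] at h1
    nlinarith

section Disintegration

variable {Ω : Type*} [MeasurableSpace Ω] {P : Measure Ω} [IsProbabilityMeasure P] {L S : Ω → ℝ}

lemma condDistrib_Iic_ae_eq (hL : Measurable L) (hS : Measurable S) {F : ℝ → ℝ} {x : ℝ}
    (hF : ∀ B : Set ℝ, MeasurableSet B →
      (P {ω | L ω ≤ x ∧ S ω ∈ B}).toReal = ∫ s in B, F s ∂(P.map S))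
    (hx : (P {ω | L ω ≤ x}).toReal ≠ 0) :
    ∀ᵐ s ∂(P.map S), (condDistrib L S P s).real (Set.Iic x) = F s := by
  have hFi : Integrable F (P.map S) := by
    by_contra hni
    have h1 := hF Set.univ MeasurableSet.univ
    rw [Measure.restrict_univ, integral_undef hni] at h1
    simp only [Set.mem_univ, and_true] at h1
    exact hx h1
  have hκ : Measurable fun s => condDistrib L S P s (Set.Iic x) :=
    Kernel.measurable_coe _ measurableSet_Iic
  have : IsProbabilityMeasure (P.map S) := Measure.isProbabilityMeasure_map hS.aemeasurable
  refine Integrable.ae_eq_of_forall_setIntegral_eq _ _ ?_ hFi fun B hB _ => ?_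
  · refine Integrable.of_bound hκ.ennreal_toReal.aestronglyMeasurable 1 (ae_of_all _ fun s => ?_)
    rw [Real.norm_of_nonneg measureReal_nonneg]
    exact measureReal_le_one
  · rw [← hF B hB]
    simp only [Measure.real]
    rw [integral_toReal hκ.aemeasurable (ae_of_all _ fun s => measure_lt_top _ _),
      ← Measure.compProd_apply_prod hB measurableSet_Iic, compProd_map_condDistrib hL.aemeasurable,
      Measure.map_apply (hS.prodMk hL) (hB.prod measurableSet_Iic)]
    congr 2
    ext ω
    simp [and_comm]

lemma measureReal_eq_integral_condDistrib (hL : Measurable L) (hS : Measurable S)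
    {A : Set (ℝ × ℝ)} (hA : MeasurableSet A) :
    Integrable (fun s => (condDistrib L S P s).real (Prod.mk s ⁻¹' A)) (P.map S) ∧
    P.real {ω | (S ω, L ω) ∈ A} =
      ∫ s, (condDistrib L S P s).real (Prod.mk s ⁻¹' A) ∂(P.map S) := by
  have hκ : Measurable fun s => condDistrib L S P s (Prod.mk s ⁻¹' A) :=
    Kernel.measurable_kernel_prodMk_left hA
  have : IsProbabilityMeasure (P.map S) := Measure.isProbabilityMeasure_map hS.aemeasurable
  constructor
  · refine Integrable.of_bound hκ.ennreal_toReal.aestronglyMeasurable 1 (ae_of_all _ fun s => ?_)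
    rw [Real.norm_of_nonneg measureReal_nonneg]
    exact measureReal_le_one
  · simp only [Measure.real]
    rw [integral_toReal hκ.aemeasurable (ae_of_all _ fun s => measure_lt_top _ _),
      ← Measure.compProd_apply hA, compProd_map_condDistrib hL.aemeasurable,
      Measure.map_apply (hS.prodMk hL) hA]
    rfl

/-- The conditional distribution function determines the conditional law of intervals. -/
lemma condDistrib_Ioc_ae_eq (hL : Measurable L) (hS : Measurable S) {F f : ℝ → ℝ → ℝ} {x₀ : ℝ}
    (hF : ∀ x : ℝ, ∀ B : Set ℝ, MeasurableSet B →
      (P {ω | L ω ≤ x ∧ S ω ∈ B}).toReal = ∫ s in B, F s x ∂(P.map S))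
    (hx : ∀ x, x₀ < x → (P {ω | L ω ≤ x}).toReal ≠ 0)
    (hf : ∀ᵐ s ∂(P.map S), (∀ x, x₀ ≤ x → 0 < f s x) ∧
      (∀ x y, x₀ ≤ x → x ≤ y → f s y ≤ f s x) ∧
      (∀ x, x₀ ≤ x → F s x = F s x₀ + ∫ y in x₀..x, f s y)) :
    ∀ᵐ s ∂(P.map S), ∀ a b, x₀ < a → a ≤ b →
      (b - a) * f s b ≤ (condDistrib L S P s).real (Set.Ioc a b) ∧
      (condDistrib L S P s).real (Set.Ioc a b) ≤ (b - a) * f s a := by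
  have hrat : ∀ᵐ s ∂(P.map S), ∀ q : ℚ, x₀ < q →
      (condDistrib L S P s).real (Set.Iic (q : ℝ)) = F s q := by
    rw [ae_all_iff]
    intro q
    by_cases hq : x₀ < q
    · filter_upwards [condDistrib_Iic_ae_eq hL hS (hF q) (hx q hq)] with s hs _ using hs
    · exact ae_of_all _ fun s h => absurd h hq
  filter_upwards [hrat, hf] with s hs ⟨hpos, hmono, hFs⟩
  have hint : ∀ a b, x₀ ≤ a → a ≤ b → IntervalIntegrable (f s) volume a b := by
    intro a b ha hab
    refine AntitoneOn.intervalIntegrable fun x hx y _ hxy => hmono x y ?_ hxy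
    rw [Set.uIcc_of_le hab] at hx
    exact ha.trans hx.1
  have hsub : ∀ a b, x₀ ≤ a → a ≤ b → F s b - F s a = ∫ y in a..b, f s y := by
    intro a b ha hab
    rw [hFs a ha, hFs b (ha.trans hab), ← intervalIntegral.integral_add_adjacent_intervals
      (hint x₀ a le_rfl ha) (hint a b ha hab)]
    ring
  have hbd : ∀ a b, x₀ ≤ a → a ≤ b →
      (b - a) * f s b ≤ F s b - F s a ∧ F s b - F s a ≤ (b - a) * f s a := by
    intro a b ha hab
    have h7 := intervalIntegral.integral_mono_on hab (intervalIntegrable_const (μ := volume))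
      (hint a b ha hab) (fun y hy => hmono y b (ha.trans hy.1) hy.2)
    have h8 := intervalIntegral.integral_mono_on hab (hint a b ha hab)
      (intervalIntegrable_const (μ := volume)) (fun y hy => hmono a y ha hy.1)
    rw [intervalIntegral.integral_const, smul_eq_mul] at h7 h8
    rw [hsub a b ha hab]
    exact ⟨h7, h8⟩
  have hall : ∀ x, x₀ < x → (condDistrib L S P s).real (Set.Iic x) = F s x := by
    intro x hx
    refine eq_of_eq_on_rat (c := fun x => (condDistrib L S P s).real (Set.Iic x)) (h := F s)
      (hpos x₀ le_rfl).le (fun a b hab => measureReal_mono (Set.Iic_subset_Iic.2 hab))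
      (fun a b ha hab => (hbd a b ha hab).2.trans ?_) hs hx
    rw [mul_comm]
    exact mul_le_mul_of_nonneg_right (hmono x₀ a le_rfl ha) (by linarith)
  intro a b ha hab
  have e : (condDistrib L S P s).real (Set.Ioc a b) = F s b - F s a := by
    rw [← hall a ha, ← hall b (ha.trans_le hab), ← Set.Iic_sdiff_Iic,
      measureReal_sdiff (Set.Iic_subset_Iic.2 hab) measurableSet_Iic]
  rw [e]
  exact hbd a b ha.le hab

/-- Lower bound for the excess probability by the first-order term. -/
lemma excess_lower (hL : Measurable L) (hS : Measurable S) {f : ℝ → ℝ → ℝ} {x₀ z a : ℝ}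
    (hz : x₀ < z - a)
    (hf : ∀ᵐ s ∂(P.map S), 0 ≤ s ∧ ∀ a b, x₀ < a → a ≤ b →
      (b - a) * f s b ≤ (condDistrib L S P s).real (Set.Ioc a b))
    (hint : Integrable (fun s => s * f s z) (P.map S)) :
    (∫ s, s * f s z ∂(P.map S)) - ∫ s in Set.Ioi a, s * f s z ∂(P.map S) ≤
      P.real {ω | L ω ≤ z ∧ z < L ω + S ω} := by
  set A : Set (ℝ × ℝ) := {p | p.1 ≤ a ∧ z - p.1 < p.2 ∧ p.2 ≤ z} with hAdef
  have hA : MeasurableSet A := by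
    refine (measurableSet_le measurable_fst measurable_const).inter
      ((measurableSet_lt (by fun_prop) measurable_snd).inter
        (measurableSet_le measurable_snd measurable_const))
  obtain ⟨hgi, hg⟩ := measureReal_eq_integral_condDistrib (P := P) hL hS hA
  have h1 : P.real {ω | (S ω, L ω) ∈ A} ≤ P.real {ω | L ω ≤ z ∧ z < L ω + S ω} := by
    refine measureReal_mono ?_
    rintro ω ⟨-, h2, h3⟩
    simp only at h2 h3
    exact ⟨h3, by linarith⟩
  refine le_trans ?_ h1
  rw [hg, ← integral_add_compl (measurableSet_Ioi (a := a)) hint, add_sub_cancel_left,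
    ← integral_indicator measurableSet_Ioi.compl]
  refine integral_mono_ae (hint.indicator measurableSet_Ioi.compl) hgi ?_
  filter_upwards [hf] with s ⟨hs0, hs⟩
  by_cases hsa : s ≤ a
  · have e : Prod.mk s ⁻¹' A = Set.Ioc (z - s) z := by
      ext y
      simp [hAdef, hsa]
    rw [Set.indicator_of_mem (by simpa using hsa), e]
    have := hs (z - s) z (by linarith) (by linarith)
    rwa [sub_sub_cancel] at this
  · rw [Set.indicator_of_notMem (by simpa using hsa)]
    exact measureReal_nonneg

/-- Upper bound for the excess probability by the first-order term and the tail of `S`. -/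
lemma excess_upper (hL : Measurable L) (hS : Measurable S) {f : ℝ → ℝ → ℝ} {x₀ z a : ℝ}
    (hz : x₀ < z - a)
    (hf : ∀ᵐ s ∂(P.map S), 0 ≤ s ∧ (∀ x, x₀ ≤ x → 0 < f s x) ∧
      (∀ x y, x₀ ≤ x → x ≤ y → f s y ≤ f s x) ∧ ∀ a b, x₀ < a → a ≤ b →
        (condDistrib L S P s).real (Set.Ioc a b) ≤ (b - a) * f s a)
    (hint : Integrable (fun s => s * f s (z - a)) (P.map S)) :
    P.real {ω | L ω ≤ z ∧ z < L ω + S ω} ≤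
      (∫ s, s * f s (z - a) ∂(P.map S)) + (P.map S).real (Set.Ioi a) := by
  set A : Set (ℝ × ℝ) := {p | p.1 ≤ a ∧ z - p.1 < p.2 ∧ p.2 ≤ z} with hAdef
  have hA : MeasurableSet A := by
    refine (measurableSet_le measurable_fst measurable_const).inter
      ((measurableSet_lt (by fun_prop) measurable_snd).inter
        (measurableSet_le measurable_snd measurable_const))
  obtain ⟨hgi, hg⟩ := measureReal_eq_integral_condDistrib (P := P) hL hS hA
  have h1 : P.real {ω | L ω ≤ z ∧ z < L ω + S ω} ≤
      P.real {ω | (S ω, L ω) ∈ A} + P.real (S ⁻¹' Set.Ioi a) := by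
    refine (measureReal_mono ?_).trans (measureReal_union_le _ _)
    rintro ω ⟨h2, h3⟩
    by_cases h : S ω ≤ a
    · exact Or.inl ⟨h, by simp only; linarith, h2⟩
    · exact Or.inr (not_le.1 h)
  rw [map_measureReal_apply hS measurableSet_Ioi]
  refine h1.trans (add_le_add_left ?_ _)
  rw [hg]
  refine integral_mono_ae hgi hint ?_
  filter_upwards [hf] with s ⟨hs0, hpos, hmono, hs⟩
  by_cases hsa : s ≤ a
  · have e : Prod.mk s ⁻¹' A = Set.Ioc (z - s) z := by
      ext y
      simp [hAdef, hsa]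
    rw [e]
    have := hs (z - s) z (by linarith) (by linarith)
    rw [sub_sub_cancel] at this
    exact this.trans (mul_le_mul_of_nonneg_left (hmono _ _ hz.le (by linarith)) hs0)
  · have e : Prod.mk s ⁻¹' A = ∅ := by
      ext y
      simp [hAdef, hsa]
    rw [e, measureReal_empty]
    exact mul_nonneg hs0 (hpos _ hz.le).le

end Disintegration

section Quantile

variable {Ω : Type*} [MeasurableSpace Ω] {P : Measure Ω} [IsProbabilityMeasure P]

lemma monotone_cdf' (X : Ω → ℝ) : Monotone (cdf' P X) := fun _ _ hab =>
  measureReal_mono (μ := P) fun _ hω => le_trans hω hab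

lemma VaR_mem_Icc {X : Ω → ℝ} (hX : ∀ ω, 0 ≤ X ω) {α a b : ℝ} (hα : 0 < α)
    (ha : cdf' P X a < α) (hb : α ≤ cdf' P X b) : VaR P X α ∈ Set.Icc a b := by
  constructor
  · exact le_csInf ⟨b, hb⟩ fun x hx =>
      le_of_lt ((monotone_cdf' X).reflect_lt (ha.trans_le hx))
  · refine csInf_le ⟨0, fun x hx => ?_⟩ hb
    by_contra! hx0
    have : {ω | X ω ≤ x} = ∅ := by
      ext ω
      simpa using hx0.trans_le (hX ω)
    have h1 : α ≤ cdf' P X x := hx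
    rw [cdf', this, measure_empty, ENNReal.toReal_zero] at h1
    linarith

/-- Where a positive density exists, high quantiles are solutions of `cdf' P X q = α`. -/
lemma eventually_cdf'_VaR {X : Ω → ℝ} (hX : Measurable X) {f : ℝ → ℝ} {x₀ : ℝ}
    (hpos : ∀ x, x₀ ≤ x → 0 < f x) (hmono : ∀ x y, x₀ ≤ x → x ≤ y → f y ≤ f x)
    (hdens : ∀ x, x₀ ≤ x → cdf' P X x = cdf' P X x₀ + ∫ y in x₀..x, f y) :
    (∀ a b, x₀ ≤ a → a ≤ b → cdf' P X b - cdf' P X a = ∫ y in a..b, f y) ∧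
    (∀ a b, x₀ ≤ a → a < b → cdf' P X a < cdf' P X b) ∧
    ∀ M, ∀ᶠ α in 𝓝[<] (1 : ℝ), M ≤ VaR P X α ∧ cdf' P X (VaR P X α) = α := by
  have hint : ∀ a b, x₀ ≤ a → a ≤ b → IntervalIntegrable f volume a b := by
    intro a b ha hab
    refine AntitoneOn.intervalIntegrable fun x hx y _ hxy => hmono x y ?_ hxy
    rw [Set.uIcc_of_le hab] at hx
    exact ha.trans hx.1
  have hsub : ∀ a b, x₀ ≤ a → a ≤ b → cdf' P X b - cdf' P X a = ∫ y in a..b, f y := by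
    intro a b ha hab
    rw [hdens a ha, hdens b (ha.trans hab), ← intervalIntegral.integral_add_adjacent_intervals
      (hint x₀ a le_rfl ha) (hint a b ha hab)]
    ring
  have hlt : ∀ a b, x₀ ≤ a → a < b → cdf' P X a < cdf' P X b := by
    intro a b ha hab
    rw [← sub_pos, hsub a b ha hab.le]
    exact intervalIntegral.intervalIntegral_pos_of_pos_on (hint a b ha hab.le)
      (fun x hx => hpos x (ha.trans hx.1.le)) hab
  refine ⟨hsub, hlt, fun M => ?_⟩
  set N := max M x₀
  have hN : x₀ ≤ N := le_max_right _ _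
  have hN1 : cdf' P X N < 1 := (hlt N (N + 1) hN (by linarith)).trans_le measureReal_le_one
  filter_upwards [Ioo_mem_nhdsLT hN1] with α hα
  have hlim : Tendsto (cdf' P X) atTop (𝓝 1) := by
    have : IsProbabilityMeasure (P.map X) := Measure.isProbabilityMeasure_map hX.aemeasurable
    refine (tendsto_cdf_atTop (P.map X)).congr fun x => ?_
    rw [cdf_eq_real, map_measureReal_apply hX measurableSet_Iic]
    rfl
  obtain ⟨R, hR1, hR2⟩ := ((hlim.eventually (lt_mem_nhds hα.2)).and (eventually_ge_atTop N)).exists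
  have hcont : ContinuousOn (cdf' P X) (Set.Icc N R) := by
    have h1 : ContinuousOn (fun x => cdf' P X N + ∫ y in N..x, f y) (Set.Icc N R) := by
      refine continuousOn_const.add ?_
      have h2 := intervalIntegral.continuousOn_primitive_interval (μ := volume) (f := f)
        (a := N) (b := R) ?_
      · rwa [Set.uIcc_of_le hR2] at h2
      · rw [Set.uIcc_of_le hR2, integrableOn_Icc_iff_integrableOn_Ioc]
        exact (intervalIntegrable_iff_integrableOn_Ioc_of_le hR2).1 (hint N R hN hR2)
    refine h1.congr fun x hx => ?_
    simp only
    rw [← hsub N x hN hx.1]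
    ring
  obtain ⟨q, hq, hqα⟩ := intermediate_value_Icc hR2 hcont ⟨hα.1.le, hR1.le⟩
  have hqN : N < q := by
    refine lt_of_le_of_ne hq.1 fun h => ?_
    rw [h, hqα] at hα
    exact lt_irrefl _ hα.1
  have hV : VaR P X α = q := by
    refine IsLeast.csInf_eq ⟨hqα.ge, fun x hx => ?_⟩
    by_contra! hxq
    have h1 := hlt (max x x₀) q (le_max_right _ _) (max_lt hxq (hN.trans_lt hqN))
    have h2 := monotone_cdf' (P := P) X (le_max_left x x₀)
    have h3 : α ≤ cdf' P X x := hx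
    linarith
  rw [hV]
  exact ⟨(le_max_left _ _).trans hqN.le, hqα⟩

end Quantile

theorem stmt18 {Ω : Type*} [MeasurableSpace Ω] (P : Measure Ω) [IsProbabilityMeasure P]
    (L S : Ω → ℝ) (hL : Measurable L) (hS : Measurable S)
    (hLpos : ∀ ω, 0 ≤ L ω) (hSpos : ∀ ω, 0 ≤ S ω)
    (β γ x₀ C η : ℝ) (hβ : 0 < β) (hβγ : β + 1 < γ) (hx₀ : 0 < x₀) (hη : γ - β < η)
    (hRVL : RegVary (tail P L) (-β)) (hRVS : RegVary (tail P S) (-γ))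
    (FLc fLc : ℝ → ℝ → ℝ) (fL : ℝ → ℝ)
    -- FLc is a regular conditional distribution function of L given S
    (hcond : ∀ x : ℝ, ∀ B : Set ℝ, MeasurableSet B →
      (P {ω | L ω ≤ x ∧ S ω ∈ B}).toReal = ∫ s in B, FLc s x ∂(P.map S))
    -- condition [E]: the conditional densities are positive, non-increasing, continuous
    (hE : ∀ᵐ s ∂(P.map S),
      (∀ x, x₀ ≤ x → 0 < fLc s x) ∧
      (∀ x y, x₀ ≤ x → x ≤ y → fLc s y ≤ fLc s x) ∧
      ContinuousOn (fLc s) (Set.Ici x₀) ∧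
      (∀ x, x₀ ≤ x → FLc s x = FLc s x₀ + ∫ y in x₀..x, fLc s y))
    -- fL is the (positive, non-increasing) marginal density of L on [x₀, ∞)
    (hfLpos : ∀ x, x₀ ≤ x → 0 < fL x)
    (hfLmono : ∀ x y, x₀ ≤ x → x ≤ y → fL y ≤ fL x)
    (hfLdens : ∀ x, x₀ ≤ x → cdf' P L x = cdf' P L x₀ + ∫ y in x₀..x, fL y)
    (hmarg : ∀ x, x₀ ≤ x → fL x = ∫ s, fLc s x ∂(P.map S))
    -- condition [F]: uniform regular variation of the conditional densities ...
    (hF1 : ∀ K : Set ℝ, K ⊆ Set.Ioc 0 1 → IsCompact K → ∀ ε > 0, ∃ X₀ : ℝ, ∀ x ≥ X₀,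
      ∀ᵐ s ∂(P.map S), ∀ t ∈ K, |fLc s (t * x) / fLc s x - t ^ (-β - 1)| ≤ ε)
    -- ... and the conditional moment bound E[S^η | L = x] ≤ C
    (hF2 : ∀ x, x₀ ≤ x → ∫ s, s ^ η * (fLc s x / fL x) ∂(P.map S) ≤ C)
 :
    Tendsto (fun α => (VaR P (fun ω => L ω + S ω) α - VaR P L α) /
        (∫ s, s * (fLc s (VaR P L α) / fL (VaR P L α)) ∂(P.map S)))
      (𝓝[<] (1 : ℝ)) (𝓝 1) := by
  set μ := P.map S with hμ
  have hμP : IsProbabilityMeasure μ := Measure.isProbabilityMeasure_map hS.aemeasurable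
  obtain ⟨hsub, hlt, hVaR⟩ := eventually_cdf'_VaR hL hfLpos hfLmono hfLdens
  have hS0 : ∀ᵐ s ∂μ, 0 ≤ s := by
    rw [hμ, ae_map_iff hS.aemeasurable measurableSet_Ici]
    exact ae_of_all _ hSpos
  have hκ := condDistrib_Ioc_ae_eq hL hS hcond
    (fun x hx => ((ENNReal.toReal_nonneg).trans_lt (hlt x₀ x le_rfl hx)).ne')
    (hE.mono fun s hs => ⟨hs.1, hs.2.1, hs.2.2.2⟩)
  have hfi : ∀ x, x₀ ≤ x → Integrable (fun s => fLc s x) μ := by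
    intro x hx
    by_contra hni
    have := hmarg x hx
    rw [integral_undef hni] at this
    exact (hfLpos x hx).ne' this
  have hbound : ∀ x, 2 * x₀ ≤ x → ∀ᵐ s ∂μ, fLc s x ≤ 4 / x := by
    intro x hx
    filter_upwards [hκ] with s hs
    have h1 := (hs (3 / 4 * x) x (by linarith) (by linarith)).1.trans measureReal_le_one
    rw [le_div_iff₀ (by linarith)]
    linarith
  -- tail of `S`
  set T : ℝ → ℝ := fun x => μ.real (Set.Ioi x) with hTdef
  have hTt : ∀ x, tail P S x = T x := fun x => (map_measureReal_apply hS measurableSet_Ioi).symm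
  have hTa : Antitone T := fun a b hab => measureReal_mono (Set.Ioi_subset_Ioi hab)
  have hT2 : Tendsto (fun x => T (2 * x) / T x) atTop (𝓝 (2 ^ (-γ))) := by
    simpa only [hTt] using hRVS 2 two_pos
  have hTpos : ∀ x, 0 < T x := by
    intro x
    obtain ⟨y, hy, hxy⟩ := ((hT2.eventually (lt_mem_nhds
      (Real.rpow_pos_of_pos two_pos (-γ)))).and (eventually_ge_atTop x)).exists
    refine lt_of_lt_of_le (lt_of_le_of_ne measureReal_nonneg fun h => ?_) (hTa hxy)
    rw [hTdef] at hy
    simp only at hy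
    rw [← h, div_zero] at hy
    exact lt_irrefl _ hy
  have hγ2 : (2 : ℝ) ^ (-γ) < 1 / 2 := by
    have : (1 / 2 : ℝ) = 2 ^ (-1 : ℝ) := by rw [Real.rpow_neg_one]; norm_num
    rw [this]
    exact Real.rpow_lt_rpow_of_exponent_lt one_lt_two (by linarith)
  obtain ⟨ρ, hρ1, hρ2⟩ := exists_between hγ2
  have hρ0 : 0 ≤ ρ := (Real.rpow_pos_of_pos two_pos _).le.trans hρ1.le
  obtain ⟨X₀, hX₀⟩ := eventually_atTop.1 (hT2.eventually (gt_mem_nhds hρ1))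
  set X := max X₀ 1
  have hX : 0 < X := one_pos.trans_le (le_max_right _ _)
  have hkar : ∀ x, X ≤ x → _ := fun x hx => lintegral_Ioi_le_of_doubling (μ := μ) hX hρ0 hρ2
    (fun x hx => ((div_lt_iff₀ (hTpos x)).1 (hX₀ x ((le_max_left _ _).trans hx))).le) hx
  have hSi : Integrable (fun s : ℝ => s) μ := by
    have h1 : IntegrableOn (fun s : ℝ => s) (Set.Ioi X) μ := by
      refine ⟨measurable_id.aestronglyMeasurable, ?_⟩
      rw [hasFiniteIntegral_iff_ofReal]
      · exact (hkar X le_rfl).trans_lt ENNReal.ofReal_lt_top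
      · exact ae_restrict_of_ae hS0
    have h2 : IntegrableOn (fun s : ℝ => s) (Set.Ioi X)ᶜ μ := by
      refine Integrable.of_bound measurable_id.aestronglyMeasurable X ?_
      filter_upwards [ae_restrict_of_ae hS0, ae_restrict_mem measurableSet_Ioi.compl] with s h3 h4
      rw [Real.norm_of_nonneg h3]
      simpa using h4
    rw [← integrableOn_univ, ← Set.union_compl_self (Set.Ioi X)]
    exact h1.union h2
  have hkar' : ∀ x, X ≤ x → ∫ s in Set.Ioi x, s ∂μ ≤ 2 * (1 - 2 * ρ)⁻¹ * (x * T x) := by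
    intro x hx
    have h0 : 0 ≤ 2 * (1 - 2 * ρ)⁻¹ * (x * T x) := by
      have h1 : 0 < 1 - 2 * ρ := by linarith
      have h2 : 0 < x := hX.trans_le hx
      have h3 := hTpos x
      positivity
    rw [integral_eq_lintegral_of_nonneg_ae (ae_restrict_of_ae hS0)
      measurable_id.aestronglyMeasurable]
    exact ENNReal.toReal_le_of_le_ofReal h0 (hkar x hx)
  -- the first-order term
  set G : ℝ → ℝ := fun x => ∫ s, s * fLc s x ∂μ with hGdef
  have hGi : ∀ x, 2 * x₀ ≤ x → Integrable (fun s => s * fLc s x) μ := by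
    intro x hx
    refine hSi.mul_bdd (c := 4 / x) (hfi x (by linarith)).aestronglyMeasurable ?_
    filter_upwards [hbound x hx, hE] with s h1 h2
    rwa [Real.norm_of_nonneg (h2.1 x (by linarith)).le]
  have hGpos : ∀ x, 2 * x₀ ≤ x → 0 < G x := by
    intro x hx
    rw [hGdef]
    simp only
    rw [integral_pos_iff_support_of_nonneg_ae _ (hGi x hx)]
    · have h1 : 0 < μ (Set.Ioi 0) := by
        have := hTpos 0
        exact (ENNReal.toReal_pos_iff.1 this).1
      refine h1.trans_le (measure_mono_ae ?_)
      filter_upwards [hE] with s h2 h3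
      exact (mul_pos h3 (h2.1 x (by linarith))).ne'
    · filter_upwards [hE, hS0] with s h2 h3
      exact mul_nonneg h3 (h2.1 x (by linarith)).le
  have hGa : ∀ x y, 2 * x₀ ≤ x → x ≤ y → G y ≤ G x := by
    intro x y hx hxy
    refine integral_mono_ae (hGi y (hx.trans hxy)) (hGi x hx) ?_
    filter_upwards [hE, hS0] with s h2 h3
    exact mul_le_mul_of_nonneg_left (h2.2.1 x y (by linarith) hxy) h3
  have hF : ∀ t ∈ Set.Ioo (0 : ℝ) 1, ∀ ε > 0, ∃ X₀ : ℝ, ∀ x ≥ X₀, ∀ᵐ s ∂μ,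
      |fLc s (t * x) / fLc s x - t ^ (-(β + 1))| ≤ ε := by
    intro t ht ε hε
    obtain ⟨X₀, h⟩ := hF1 {t} (by simpa using ⟨ht.1, ht.2.le⟩) isCompact_singleton ε hε
    refine ⟨X₀, fun x hx => (h x hx).mono fun s hs => ?_⟩
    have := hs t rfl
    rwa [show -β - 1 = -(β + 1) by ring] at this
  have hfp : ∀ᵐ s ∂μ, ∀ x, 2 * x₀ ≤ x → 0 < fLc s x :=
    hE.mono fun s hs x hx => hs.1 x (by linarith)
  have hGr : ∀ t ∈ Set.Ioo (0 : ℝ) 1,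
      Tendsto (fun x => G (t * x) / G x) atTop (𝓝 (t ^ (-(β + 1)))) := fun t ht =>
    tendsto_mixture_ratio ht.1 hS0 hfp hGi hGpos (hF t ht)
  have hfr : ∀ t ∈ Set.Ioo (0 : ℝ) 1,
      Tendsto (fun x => fL (t * x) / fL x) atTop (𝓝 (t ^ (-(β + 1)))) := by
    intro t ht
    have h1 := tendsto_mixture_ratio (μ := μ) (f := fLc) (w := fun _ => 1) (x₁ := x₀) ht.1
      (ae_of_all _ fun _ => zero_le_one) (hE.mono fun s hs => hs.1)
      (fun x hx => by simpa using hfi x hx)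
      (fun x hx => by simpa [← hmarg x hx] using hfLpos x hx) (hF t ht)
    refine h1.congr' ?_
    filter_upwards [eventually_ge_atTop x₀, eventually_ge_atTop (x₀ / t)] with x h2 h3
    rw [div_le_iff₀ ht.1, mul_comm] at h3
    simp only [one_mul]
    rw [← hmarg _ h2, ← hmarg _ h3]
  have hTG : Tendsto (fun x => T x / G x) atTop (𝓝 0) := by
    refine tendsto_div_zero (x₁ := 2 * x₀) (l := 2 ^ (-γ) * 2 ^ (β + 1)) ?_ (fun x _ => hTpos x)
      hGpos (fun X _ => ⟨1, fun x _ _ => measureReal_le_one⟩)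
      (fun X hX => ⟨G (2 * X), hGpos _ (by linarith), fun x hx hx2 =>
        hGa x _ (hX.trans hx) hx2⟩) ?_
    · rw [← Real.rpow_add two_pos]
      exact Real.rpow_lt_one_of_one_lt_of_neg one_lt_two (by linarith)
    · refine (hT2.mul (tendsto_ratio_two hGr)).congr fun x => ?_
      rw [div_mul_div_comm, div_div_div_eq, mul_comm (T x)]
  -- asymptotics of the excess probability
  set D : ℝ → ℝ := fun z => P.real {ω | L ω ≤ z ∧ z < L ω + S ω} with hDdef
  have hD : ∀ ε > 0, ∀ᶠ z in atTop, (1 - ε) * G z ≤ D z ∧ D z ≤ (1 + ε) * G z := by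
    intro ε hε
    refine excess_equiv (T := T) (c := 4 * (1 - 2 * ρ)⁻¹)
      (eventually_atTop.2 ⟨2 * x₀, hGpos⟩) hGr hTG ?_ ?_ hε
    · filter_upwards [eventually_ge_atTop (2 * X), eventually_gt_atTop (2 * x₀)] with z hz1 hz2
      have h1 := excess_lower (x₀ := x₀) (z := z) (a := 1 / 2 * z) hL hS (by linarith)
        (hS0.and (hκ.mono fun s hs a b ha hab => (hs a b ha hab).1)) (hGi z hz2.le)
      refine le_trans (sub_le_sub_left ?_ _) h1
      have hz0 : 0 < z := by linarith
      calc ∫ s in Set.Ioi (1 / 2 * z), s * fLc s z ∂μ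
          ≤ ∫ s in Set.Ioi (1 / 2 * z), 4 / z * s ∂μ := by
            refine integral_mono_ae (hGi z hz2.le).integrableOn
              (hSi.const_mul _).integrableOn (ae_restrict_of_ae ?_)
            filter_upwards [hS0, hbound z hz2.le] with s h2 h3
            rw [mul_comm]
            exact mul_le_mul_of_nonneg_right h3 h2
        _ = 4 / z * ∫ s in Set.Ioi (1 / 2 * z), s ∂μ := integral_const_mul _ _
        _ ≤ 4 / z * (2 * (1 - 2 * ρ)⁻¹ * (1 / 2 * z * T (1 / 2 * z))) := by
            gcongr
            exact hkar' _ (by linarith)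
        _ = 4 * (1 - 2 * ρ)⁻¹ * T (1 / 2 * z) := by
            field_simp
    · intro t ht
      filter_upwards [eventually_gt_atTop (2 * x₀ / t)] with z hz
      rw [div_lt_iff₀ ht.1, mul_comm z] at hz
      have e : z - (1 - t) * z = t * z := by ring
      have h1 := excess_upper (x₀ := x₀) (z := z) (a := (1 - t) * z) (f := fLc) hL hS
        (by rw [e]; linarith)
        (by
          filter_upwards [hS0, hE, hκ] with s h1 h2 h3
          exact ⟨h1, h2.1, h2.2.1, fun a b ha hab => (h3 a b ha hab).2⟩)
        (by rw [e]; exact hGi _ hz.le)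
      rwa [e] at h1
  have hcdf : ∀ z, cdf' P (fun ω => L ω + S ω) z = cdf' P L z - D z := by
    intro z
    have h1 : P.real ({ω | L ω ≤ z} \ {ω | L ω ≤ z ∧ z < L ω + S ω}) =
        P.real {ω | L ω ≤ z} - P.real {ω | L ω ≤ z ∧ z < L ω + S ω} :=
      measureReal_sdiff (fun ω h => h.1)
        ((measurableSet_le hL measurable_const).inter
          (measurableSet_lt measurable_const (hL.add hS)))
    refine Eq.trans ?_ h1
    change P.real _ = P.real _
    congr 1
    ext ω
    have := hSpos ω
    simp only [Set.mem_ofPred_eq, Set.mem_sdiff, not_and, not_lt]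
    exact ⟨fun h => ⟨by linarith, fun _ => h⟩, fun h => h.2 h.1⟩
  -- inversion
  rw [Metric.tendsto_nhds]
  intro ε₀ hε₀
  obtain ⟨ε, hε, hεlt⟩ : ∃ ε : ℝ, 0 < ε ∧ ε < min ε₀ 1 := exists_between (by positivity)
  have hεε := hεlt.trans_le (min_le_left _ _)
  have hε1 := hεlt.trans_le (min_le_right _ _)
  obtain ⟨Q, hQ⟩ := eventually_atTop.1 (shift_bounds hε hε1 hGpos hGa hGr
    (fun x hx => hfLpos x (by linarith)) (fun x y hx hxy => hfLmono x y (by linarith) hxy) hfr hD)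
  filter_upwards [hVaR (max Q (2 * x₀)), Ioo_mem_nhdsLT (zero_lt_one' ℝ)] with α ⟨hq, hqα⟩ hα
  set q := VaR P L α
  obtain ⟨h1, h2⟩ := hQ q ((le_max_left _ _).trans hq)
  have hqx : 2 * x₀ ≤ q := (le_max_right _ _).trans hq
  have hm0 : 0 < G q / fL q := div_pos (hGpos q hqx) (hfLpos q (by linarith))
  have e : ∫ s, s * (fLc s q / fL q) ∂μ = G q / fL q := by
    rw [hGdef, ← integral_div]
    simp only [mul_div_assoc]
  rw [e]
  set m := G q / fL q
  have h3 := mul_pos (show 0 < 1 - ε by linarith) hm0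
  have h4 := mul_pos (show 0 < 1 + ε by linarith) hm0
  have h5 := VaR_mem_Icc (X := fun ω => L ω + S ω) (P := P) (a := q + (1 - ε) * m)
    (b := q + (1 + ε) * m) (fun ω => add_nonneg (hLpos ω) (hSpos ω)) hα.1
    (by
      rw [hcdf]
      have := hsub q (q + (1 - ε) * m) (by linarith) (by linarith)
      linarith)
    (by
      rw [hcdf]
      have := hsub q (q + (1 + ε) * m) (by linarith) (by linarith)
      linarith)
  rw [Real.dist_eq]
  refine lt_of_le_of_lt (abs_le.2 ⟨?_, ?_⟩) hεε
  · have : 1 - ε ≤ (VaR P (fun ω => L ω + S ω) α - q) / m := by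
      rw [le_div_iff₀ hm0]
      linarith [h5.1]
    linarith
  · have : (VaR P (fun ω => L ω + S ω) α - q) / m ≤ 1 + ε := by
      rw [div_le_iff₀ hm0]
      linarith [h5.2]
    linarith
end
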